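/- arXiv:0912.2837 — 2 statements merged into one kernel-verified Lean document; each statement's English description precedes it below -/
import Mathlib

section
/- Let ζ : [0,∞) → ℝ be Borel measurable and bounded on compact intervals, let β ∈ ℝ, and let Q : [0,∞) → ℝ be Borel measurable, bounded on compact intervals, and satisfy Q(t) = ζ(t) − βF_e(t) + ∫_{[0,t]} Q⁺(t−s) dμ(s) for all t ≥ 0. Then Q(t) = ζ(t) + ∫_{[0,t]} ζ(t−u) dν(u) − βt − ∫_{[0,t]} Q⁻(t−u) dν(u) for all t ≥ 0. -/
open MeasureTheory Set

/-- Convolution of two Borel measures on `ℝ` (pushforward of the product under addition). -/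
noncomputable def convMeas (μ ν : Measure ℝ) : Measure ℝ :=
  Measure.map (fun p : ℝ × ℝ => p.1 + p.2) (μ.prod ν)

/-- `n`-fold convolution power of a measure on `ℝ` (the `0`-th power is `δ₀`). -/
noncomputable def convPow (μ : Measure ℝ) : ℕ → Measure ℝ
  | 0 => Measure.dirac 0
  | n + 1 => convMeas (convPow μ n) μ

/-- The renewal measure `ν = Σ_{n≥1} μ^{*n}`. -/
noncomputable def renewalMeasure (μ : Measure ℝ) : Measure ℝ :=
  Measure.sum (fun n : ℕ => convPow μ (n + 1))

open scoped Measure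

theorem ae_nonneg_conv {μ ν : Measure ℝ} [SFinite μ] [SFinite ν]
    (hμ : ∀ᵐ x ∂μ, 0 ≤ x) (hν : ∀ᵐ x ∂ν, 0 ≤ x) : ∀ᵐ x ∂convMeas μ ν, 0 ≤ x := by
  rw [convMeas, ae_map_iff (by fun_prop) measurableSet_Ici]
  filter_upwards [Measure.quasiMeasurePreserving_fst.ae hμ,
    Measure.quasiMeasurePreserving_snd.ae hν] with p h1 h2
  exact add_nonneg h1 h2

instance isProbabilityMeasure_convPow (μ : Measure ℝ) [IsProbabilityMeasure μ] :
    ∀ n, IsProbabilityMeasure (convPow μ n)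
  | 0 => Measure.dirac.isProbabilityMeasure
  | n + 1 => by
    have := isProbabilityMeasure_convPow μ n
    exact Measure.isProbabilityMeasure_map (by fun_prop)

instance sFinite_renewalMeasure (μ : Measure ℝ) [IsProbabilityMeasure μ] :
    SFinite (renewalMeasure μ) := by
  unfold renewalMeasure
  infer_instance

theorem ae_nonneg_convPow {μ : Measure ℝ} [IsProbabilityMeasure μ] (hμ : ∀ᵐ x ∂μ, 0 ≤ x) :
    ∀ n, ∀ᵐ x ∂convPow μ n, 0 ≤ x
  | 0 => by simp [convPow]
  | n + 1 => ae_nonneg_conv (ae_nonneg_convPow hμ n) hμ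

theorem ae_nonneg_renewalMeasure {μ : Measure ℝ} [IsProbabilityMeasure μ]
    (hμ : ∀ᵐ x ∂μ, 0 ≤ x) : ∀ᵐ x ∂renewalMeasure μ, 0 ≤ x := by
  rw [renewalMeasure, Measure.ae_sum_iff]
  exact fun n => ae_nonneg_convPow hμ _

theorem renewalMeasure_eq_add_conv (μ : Measure ℝ) [IsProbabilityMeasure μ] :
    renewalMeasure μ = μ + renewalMeasure μ ∗ μ := by
  have h1 : convPow μ 1 = μ := Measure.dirac_zero_conv μ
  have h2 : renewalMeasure μ ∗ μ = Measure.sum fun n => convPow μ (n + 2) := by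
    rw [renewalMeasure, Measure.conv, Measure.prod_sum_left, Measure.map_sum (by fun_prop)]
    rfl
  rw [h2]
  ext s hs
  rw [renewalMeasure, Measure.add_apply, Measure.sum_apply _ hs, Measure.sum_apply _ hs,
    tsum_eq_zero_add' ENNReal.summable, zero_add, h1]

theorem integrableOn_comp_sub_of_locally_bounded {m : Measure ℝ} {f : ℝ → ℝ} {t : ℝ}
    (hm : m (Icc 0 t) < ⊤) (hf : Measurable f) (hb : ∃ C, ∀ x ∈ Icc 0 t, |f x| ≤ C) :
    IntegrableOn (fun u => f (t - u)) (Icc 0 t) m := by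
  obtain ⟨C, hC⟩ := hb
  refine IntegrableOn.of_bound hm
    (hf.comp (measurable_const.sub measurable_id)).aestronglyMeasurable C ?_
  refine ae_restrict_of_forall_mem measurableSet_Icc fun u hu => hC _ ?_
  exact ⟨by linarith [hu.2], by linarith [hu.1]⟩

theorem setIntegral_conv_comp_sub {μ ν : Measure ℝ} [SFinite μ] [SFinite ν]
    (hμ : ∀ᵐ x ∂μ, 0 ≤ x) (hν : ∀ᵐ x ∂ν, 0 ≤ x) {f : ℝ → ℝ} {t : ℝ}
    (hfint : IntegrableOn (fun w => f (t - w)) (Icc 0 t) (ν ∗ μ)) :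
    ∫ w in Icc 0 t, f (t - w) ∂(ν ∗ μ)
      = ∫ u in Icc 0 t, ∫ s in Icc 0 (t - u), f (t - u - s) ∂μ ∂ν := by
  rw [← integral_indicator measurableSet_Icc,
    integral_conv ((integrable_indicator_iff measurableSet_Icc).2 hfint),
    ← integral_indicator measurableSet_Icc]
  refine integral_congr_ae ?_
  filter_upwards [hν] with u hu
  by_cases hut : u ≤ t
  · rw [indicator_of_mem (show u ∈ Icc 0 t from ⟨hu, hut⟩), ← integral_indicator measurableSet_Icc]
    refine integral_congr_ae ?_
    filter_upwards [hμ] with s hs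
    have : u + s ∈ Icc 0 t ↔ s ∈ Icc 0 (t - u) := by
      simp only [mem_Icc]
      constructor <;> rintro ⟨_, _⟩ <;> constructor <;> linarith
    simp only [indicator_apply, this, sub_sub]
  · rw [indicator_of_notMem (fun h => hut h.2)]
    refine integral_eq_zero_of_ae ?_
    filter_upwards [hμ] with s hs
    exact indicator_of_notMem (fun h => hut (by linarith [h.2])) _

/-- The solution of the renewal equation `K = g + K * μ` is `K = g + g * ν`. -/
theorem renewal_equation_solution {μ : Measure ℝ} [IsProbabilityMeasure μ]
    (hμ : ∀ᵐ x ∂μ, 0 ≤ x) {K g : ℝ → ℝ} {t : ℝ} (ht : 0 ≤ t)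
    (hfin : renewalMeasure μ (Icc 0 t) < ⊤)
    (hKm : Measurable K) (hgm : Measurable g)
    (hKb : ∃ C, ∀ x ∈ Icc 0 t, |K x| ≤ C) (hgb : ∃ C, ∀ x ∈ Icc 0 t, |g x| ≤ C)
    (hK : ∀ x, 0 ≤ x → K x = g x + ∫ s in Icc 0 x, K (x - s) ∂μ) :
    K t = g t + ∫ u in Icc 0 t, g (t - u) ∂renewalMeasure μ := by
  have hKi := integrableOn_comp_sub_of_locally_bounded hfin hKm hKb
  have hgi := integrableOn_comp_sub_of_locally_bounded hfin hgm hgb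
  have hdec := renewalMeasure_eq_add_conv μ
  have hKi' := hKi
  rw [hdec, integrableOn_add_measure] at hKi'
  have hconv := setIntegral_conv_comp_sub hμ (ae_nonneg_renewalMeasure hμ) hKi'.2
  have hsub : ∫ u in Icc 0 t, ∫ s in Icc 0 (t - u), K (t - u - s) ∂μ ∂renewalMeasure μ
      = ∫ u in Icc 0 t, (K (t - u) - g (t - u)) ∂renewalMeasure μ := by
    refine setIntegral_congr_fun measurableSet_Icc fun u hu => ?_
    simp only [hK (t - u) (by linarith [hu.2]), add_sub_cancel_left]
  rw [integral_sub hKi hgi] at hsub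
  have hsplit : ∫ u in Icc 0 t, K (t - u) ∂renewalMeasure μ
      = (∫ u in Icc 0 t, K (t - u) ∂μ)
        + ∫ u in Icc 0 t, K (t - u) ∂(renewalMeasure μ ∗ μ) := by
    conv_lhs => rw [hdec]
    rw [Measure.restrict_add,
      integral_add_measure hKi'.1 hKi'.2]
  rw [hK t ht]
  linarith

theorem setIntegral_sub_eq_intervalIntegral_cdf (μ : Measure ℝ) [IsFiniteMeasure μ] {t : ℝ}
    (ht : 0 ≤ t) :
    ∫ s in Icc 0 t, (t - s) ∂μ = ∫ u in (0 : ℝ)..t, (μ (Icc 0 u)).toReal := by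
  have hmeas : MeasurableSet {p : ℝ × ℝ | p.1 ≤ p.2} :=
    measurableSet_le measurable_fst measurable_snd
  have hfint : Integrable (Function.uncurry fun s u : ℝ => (Ici s).indicator (fun _ => (1 : ℝ)) u)
      ((μ.restrict (Icc 0 t)).prod (volume.restrict (Ioc 0 t))) := by
    have : (Function.uncurry fun s u : ℝ => (Ici s).indicator (fun _ => (1 : ℝ)) u)
        = {p : ℝ × ℝ | p.1 ≤ p.2}.indicator fun _ => 1 := by
      ext p
      simp [Function.uncurry, indicator_apply]
    rw [this]
    exact (integrable_const _).indicator hmeas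
  rw [intervalIntegral.integral_of_le ht]
  calc ∫ s in Icc 0 t, (t - s) ∂μ
      = ∫ s in Icc 0 t, (∫ u in Ioc 0 t, (Ici s).indicator (fun _ => (1 : ℝ)) u) ∂μ := by
        refine setIntegral_congr_fun measurableSet_Icc fun s hs => ?_
        rw [← integral_Icc_eq_integral_Ioc, setIntegral_indicator measurableSet_Ici]
        have : Icc 0 t ∩ Ici s = Icc s t := by
          ext u
          simp only [mem_inter_iff, mem_Icc, mem_Ici]
          constructor
          · rintro ⟨⟨_, h⟩, h'⟩
            exact ⟨h', h⟩
          · rintro ⟨h', h⟩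
            exact ⟨⟨hs.1.trans h', h⟩, h'⟩
        simp [this, hs.2]
    _ = ∫ u in Ioc 0 t, ∫ s in Icc 0 t, (Ici s).indicator (fun _ => (1 : ℝ)) u ∂μ :=
        integral_integral_swap hfint
    _ = ∫ u in Ioc 0 t, (μ (Icc 0 u)).toReal := by
        refine setIntegral_congr_fun measurableSet_Ioc fun u hu => ?_
        have : (fun s : ℝ => (Ici s).indicator (fun _ => (1 : ℝ)) u)
            = (Iic u).indicator fun _ => 1 := by
          ext s
          simp [indicator_apply]
        simp only [this]
        rw [setIntegral_indicator measurableSet_Iic]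
        have : Icc 0 t ∩ Iic u = Icc 0 u := by
          ext s
          simp only [mem_inter_iff, mem_Icc, mem_Iic]
          constructor
          · rintro ⟨⟨h, _⟩, h'⟩
            exact ⟨h, h'⟩
          · rintro ⟨h, h'⟩
            exact ⟨⟨h, h'.trans hu.2⟩, h'⟩
        simp [this, Measure.real]

theorem intervalIntegrable_cdf (μ : Measure ℝ) [IsFiniteMeasure μ] (a b : ℝ) :
    IntervalIntegrable (fun u => (μ (Icc 0 u)).toReal) volume a b :=
  Monotone.intervalIntegrable fun _ _ h =>
    ENNReal.toReal_mono (measure_ne_top _ _) (measure_mono (Icc_subset_Icc_right h))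

/-- Corollary 5.2 (one direction): a solution of the stochastic convolution equation
`Q(t) = ζ(t) - βF_e(t) + ∫_{[0,t]} Q⁺(t-s) dμ(s)` also satisfies the renewal-function
representation
`Q(t) = ζ(t) + ∫_{[0,t]} ζ(t-u) dν(u) - βt - ∫_{[0,t]} Q⁻(t-u) dν(u)`. -/
theorem stmt_8
    (μ : Measure ℝ) [IsProbabilityMeasure μ] (hμsupp : μ (Iio (0 : ℝ)) = 0)
    (hmean : ∫ u in Ici (0 : ℝ), u ∂μ = 1)
    (h0 : μ {(0 : ℝ)} < 1)
    (F G Fe : ℝ → ℝ)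
    (hF : ∀ t, F t = (μ (Icc (0 : ℝ) t)).toReal)
    (hG : ∀ t, G t = 1 - F t)
    (hFe : ∀ t, Fe t = ∫ u in (0 : ℝ)..t, G u)
    (ν : Measure ℝ) (hν : ν = renewalMeasure μ)
    (hνfin : ∀ t, 0 ≤ t → ν (Icc (0 : ℝ) t) < ⊤)
    (ζ : ℝ → ℝ) (hζm : Measurable ζ)
    (hζb : ∀ T, 0 ≤ T → ∃ C, ∀ t ∈ Icc (0 : ℝ) T, |ζ t| ≤ C)
    (β : ℝ)
    (Q : ℝ → ℝ) (hQm : Measurable Q)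
    (hQb : ∀ T, 0 ≤ T → ∃ C, ∀ t ∈ Icc (0 : ℝ) T, |Q t| ≤ C)
    (hQeq : ∀ t, 0 ≤ t →
      Q t = ζ t - β * Fe t + ∫ s in Icc (0 : ℝ) t, max (Q (t - s)) 0 ∂μ) :
    ∀ t, 0 ≤ t →
      Q t = ζ t + (∫ u in Icc (0 : ℝ) t, ζ (t - u) ∂ν) - β * t
        - ∫ u in Icc (0 : ℝ) t, min (Q (t - u)) 0 ∂ν := by
  intro t ht
  subst hν
  have hμ : ∀ᵐ x ∂μ, 0 ≤ x := by
    rw [ae_iff]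
    simp only [not_le]
    exact hμsupp
  have hFe' : ∀ x, 0 ≤ x → Fe x = x - ∫ s in Icc 0 x, (x - s) ∂μ := by
    intro x hx
    rw [hFe, setIntegral_sub_eq_intervalIntegral_cdf μ hx]
    simp only [hG, hF]
    rw [intervalIntegral.integral_sub (by simp) (intervalIntegrable_cdf μ 0 x)]
    simp
  have hbound : ∀ x, 0 ≤ x → ∃ C, ∀ y ∈ Icc 0 x, |max (Q y) 0| ≤ C ∧ |min (Q y) 0| ≤ C := by
    intro x hx
    obtain ⟨C, hC⟩ := hQb x hx
    refine ⟨C, fun y hy => ⟨?_, ?_⟩⟩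
    · exact (abs_max_le_max_abs_abs.trans (by simp)).trans (hC y hy)
    · exact (abs_min_le_max_abs_abs.trans (by simp)).trans (hC y hy)
  have hposI : ∀ x, 0 ≤ x → IntegrableOn (fun u => max (Q (x - u)) 0) (Icc 0 x) μ := fun x hx =>
    integrableOn_comp_sub_of_locally_bounded (f := fun y => max (Q y) 0) (measure_lt_top _ _)
      (by fun_prop) ((hbound x hx).imp fun C hC y hy => (hC y hy).1)
  have hlinI : ∀ x, 0 ≤ x → IntegrableOn (fun u => β * (x - u)) (Icc 0 x) μ := fun x hx =>
    (Continuous.integrableOn_Icc (by fun_prop))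
  have hK : ∀ x, 0 ≤ x → max (Q x) 0 + β * x = (ζ x - min (Q x) 0)
      + ∫ s in Icc 0 x, (max (Q (x - s)) 0 + β * (x - s)) ∂μ := by
    intro x hx
    rw [integral_add (hposI x hx) (hlinI x hx), integral_const_mul]
    have h1 := hQeq x hx
    rw [hFe' x hx] at h1
    linarith [max_add_min (Q x) 0]
  obtain ⟨C, hC⟩ := hbound t ht
  obtain ⟨D, hD⟩ := hζb t ht
  have hsol := renewal_equation_solution (K := fun x => max (Q x) 0 + β * x)
    (g := fun x => ζ x - min (Q x) 0) hμ ht (hνfin t ht) (by fun_prop) (by fun_prop)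
    ⟨C + |β| * t, fun x hx => (abs_add_le _ _).trans (add_le_add (hC x hx).1 (by
      rw [abs_mul, abs_of_nonneg hx.1]
      exact mul_le_mul_of_nonneg_left hx.2 (abs_nonneg β)))⟩
    ⟨D + C, fun x hx => (abs_sub _ _).trans (add_le_add (hD x hx) (hC x hx).2)⟩ hK
  rw [integral_sub
    (integrableOn_comp_sub_of_locally_bounded (hνfin t ht) hζm ⟨D, hD⟩)
    (integrableOn_comp_sub_of_locally_bounded (f := fun y => min (Q y) 0) (hνfin t ht)
      (by fun_prop) ⟨C, fun x hx => (hC x hx).2⟩)] at hsol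
  linarith [max_add_min (Q t) 0]
end

section
/- For all Borel measurable functions x, y : [0,∞) → ℝ that are bounded on compact intervals and every T ≥ 0: sup_{0 ≤ t ≤ T} |f₃(x)(t) − f₃(y)(t)| ≤ 3 · sup_{0 ≤ t ≤ T} |x(t) − y(t)|. In particular, if x_n → x uniformly on every compact interval [0,T], then f₃(x_n) → f₃(x) uniformly on every compact interval [0,T]. -/
open MeasureTheory Set

/-- The convolution map `f₃(x)(t) = ∫_0^t G(t-s) dx(s)` in its integration-by-parts
form: `f₃(x)(t) = G(0)x(t) - x(0)G(t) + ∫_{(0,t]} x(t-s) dμ(s)`, where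
`G(t) = μ((t,∞))`. -/
noncomputable def fthree (μ : Measure ℝ) (x : ℝ → ℝ) : ℝ → ℝ := fun t =>
  (μ (Ioi (0 : ℝ))).toReal * x t - x 0 * (μ (Ioi t)).toReal +
    ∫ s in Ioc (0 : ℝ) t, x (t - s) ∂μ

/-- A measurable function bounded on `[0,t]` is integrable on `(0,t]` after the reflection
`s ↦ t - s`, against any finite measure. -/
lemma integrableOn_comp_sub_of_bounded (μ : Measure ℝ) [IsFiniteMeasure μ] {x : ℝ → ℝ}
    (hx : Measurable x) {t C : ℝ} (hC : ∀ s ∈ Icc (0 : ℝ) t, |x s| ≤ C) :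
    IntegrableOn (fun s => x (t - s)) (Ioc 0 t) μ := by
  refine IntegrableOn.of_bound (measure_lt_top μ _)
    (hx.comp (measurable_const.sub measurable_id)).aestronglyMeasurable C ?_
  refine (ae_restrict_iff' measurableSet_Ioc).2 (Filter.Eventually.of_forall fun s hs => ?_)
  exact hC _ ⟨sub_nonneg.2 hs.2, sub_le_self _ hs.1.le⟩

/-- Pointwise form of the Lipschitz estimate for `fthree`. -/
lemma abs_fthree_sub_fthree_le (μ : Measure ℝ) [IsProbabilityMeasure μ] {x y : ℝ → ℝ}
    (hx : Measurable x) (hy : Measurable y) {t A B D : ℝ} (ht : 0 ≤ t)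
    (hA : ∀ s ∈ Icc (0 : ℝ) t, |x s| ≤ A) (hB : ∀ s ∈ Icc (0 : ℝ) t, |y s| ≤ B)
    (hD : ∀ s ∈ Icc (0 : ℝ) t, |x s - y s| ≤ D) :
    |fthree μ x t - fthree μ y t| ≤ 3 * D := by
  have hD0 : 0 ≤ D := (abs_nonneg _).trans (hD 0 ⟨le_rfl, ht⟩)
  have hint : |∫ s in Ioc (0 : ℝ) t, (x (t - s) - y (t - s)) ∂μ| ≤ D := by
    have h := norm_setIntegral_le_of_norm_le_const (μ := μ) (s := Ioc (0 : ℝ) t)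
      (f := fun s => x (t - s) - y (t - s)) (C := D) (measure_lt_top μ _)
      (fun s hs => hD _ ⟨sub_nonneg.2 hs.2, sub_le_self _ hs.1.le⟩)
    exact h.trans (mul_le_of_le_one_right hD0 measureReal_le_one)
  have hprod : ∀ S : Set ℝ, ∀ s ∈ Icc (0 : ℝ) t, |μ.real S * (x s - y s)| ≤ D := by
    intro S s hs
    rw [abs_mul, abs_of_nonneg measureReal_nonneg]
    exact (mul_le_of_le_one_left (abs_nonneg _) measureReal_le_one).trans (hD s hs)
  have heq : fthree μ x t - fthree μ y t =
      μ.real (Ioi 0) * (x t - y t) - μ.real (Ioi t) * (x 0 - y 0) +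
        ∫ s in Ioc (0 : ℝ) t, (x (t - s) - y (t - s)) ∂μ := by
    rw [integral_sub (integrableOn_comp_sub_of_bounded μ hx hA)
      (integrableOn_comp_sub_of_bounded μ hy hB)]
    simp only [fthree, Measure.real]
    ring
  have h₁ := abs_le.1 (hprod (Ioi 0) t ⟨ht, le_rfl⟩)
  have h₂ := abs_le.1 (hprod (Ioi t) 0 ⟨le_rfl, ht⟩)
  have h₃ := abs_le.1 hint
  rw [heq, abs_le]
  constructor <;> linarith

/-- Part of Lemma A.9: the map `f₃` satisfies
`‖f₃(x) - f₃(y)‖_T ≤ 3‖x - y‖_T`, and is therefore continuous with respect to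
uniform convergence on compact intervals. -/
theorem stmt_11
    (μ : Measure ℝ) [IsProbabilityMeasure μ] (hμsupp : μ (Iio (0 : ℝ)) = 0) :
    (∀ x y : ℝ → ℝ, Measurable x → Measurable y →
      (∀ T, 0 ≤ T → ∃ C, ∀ t ∈ Icc (0 : ℝ) T, |x t| ≤ C) →
      (∀ T, 0 ≤ T → ∃ C, ∀ t ∈ Icc (0 : ℝ) T, |y t| ≤ C) →
      ∀ T, 0 ≤ T →
        sSup ((fun t => |fthree μ x t - fthree μ y t|) '' Icc (0 : ℝ) T) ≤
          3 * sSup ((fun t => |x t - y t|) '' Icc (0 : ℝ) T)) ∧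
    (∀ (xs : ℕ → ℝ → ℝ) (x : ℝ → ℝ),
      (∀ n, Measurable (xs n)) →
      (∀ n T, 0 ≤ T → ∃ C, ∀ t ∈ Icc (0 : ℝ) T, |xs n t| ≤ C) →
      Measurable x →
      (∀ T, 0 ≤ T → ∃ C, ∀ t ∈ Icc (0 : ℝ) T, |x t| ≤ C) →
      (∀ T, 0 ≤ T → TendstoUniformlyOn (fun n => xs n) x Filter.atTop (Icc (0 : ℝ) T)) →
      ∀ T, 0 ≤ T →
        TendstoUniformlyOn (fun n => fthree μ (xs n)) (fthree μ x) Filter.atTop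
          (Icc (0 : ℝ) T)) := by
  constructor
  · intro x y hx hy hbx hby T hT
    obtain ⟨A, hA⟩ := hbx T hT
    obtain ⟨B, hB⟩ := hby T hT
    have hbdd : BddAbove ((fun t => |x t - y t|) '' Icc (0 : ℝ) T) := by
      refine ⟨A + B, ?_⟩
      rintro _ ⟨t, ht, rfl⟩
      exact (abs_sub _ _).trans (add_le_add (hA t ht) (hB t ht))
    refine csSup_le ((nonempty_Icc.2 hT).image _) ?_
    rintro _ ⟨t, ht, rfl⟩
    have hsub : Icc (0 : ℝ) t ⊆ Icc 0 T := Icc_subset_Icc_right ht.2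
    exact abs_fthree_sub_fthree_le μ hx hy ht.1 (fun s hs => hA s (hsub hs))
      (fun s hs => hB s (hsub hs)) (fun s hs => le_csSup hbdd ⟨s, hsub hs, rfl⟩)
  · intro xs x hxs hbxs hx hbx hlim T hT
    obtain ⟨A, hA⟩ := hbx T hT
    rw [Metric.tendstoUniformlyOn_iff]
    intro ε hε
    filter_upwards [Metric.tendstoUniformlyOn_iff.1 (hlim T hT) (ε / 4) (by positivity)]
      with n hn t ht
    obtain ⟨B, hB⟩ := hbxs n T hT
    have hsub : Icc (0 : ℝ) t ⊆ Icc 0 T := Icc_subset_Icc_right ht.2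
    have h := abs_fthree_sub_fthree_le μ hx (hxs n) ht.1 (fun s hs => hA s (hsub hs))
      (fun s hs => hB s (hsub hs)) (fun s hs => (hn s (hsub hs)).le)
    rw [Real.dist_eq]
    linarith
end
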